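/- arXiv:1902.05045 — 3 statements merged into one kernel-verified Lean document; each statement's English description precedes it below -/
import Mathlib

section
/- There exists a unique function J⋆ : S → ℝ such that T J⋆ = J⋆. -/
open Finset

/-- There exists a unique fixed point `J⋆` of the Bellman operator `T` of the stopping game. -/
theorem bellman_operator_unique_fixed_point
    {S A : Type*} [Fintype S] [Nonempty S] [Fintype A] [Nonempty A]
    (R : S → A → ℝ) (G : S → ℝ) (γ : ℝ) (hγ0 : 0 ≤ γ) (hγ1 : γ < 1)
    (P : S → A → S → ℝ)
    (hP0 : ∀ s a s', 0 ≤ P s a s')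
    (hP1 : ∀ s a, ∑ s', P s a s' = 1)
    (T : (S → ℝ) → (S → ℝ))
    (hT : ∀ J : S → ℝ, ∀ s : S,
      T J s = min (univ.sup' univ_nonempty
        (fun a => R s a + γ * ∑ s', P s a s' * J s')) (G s)) :
    ∃! Jstar : S → ℝ, T Jstar = Jstar := by
  have key : ∀ (J K : S → ℝ) (s : S), T J s ≤ T K s + γ * dist J K := by
    intro J K s
    have hd : 0 ≤ γ * dist J K := mul_nonneg hγ0 dist_nonneg
    rw [hT J s, hT K s, ← min_add_add_right]
    refine min_le_min ?_ (by linarith)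
    refine Finset.sup'_le _ _ fun a _ => ?_
    have h1 : ∑ s', P s a s' * J s' ≤ ∑ s', P s a s' * K s' + dist J K := by
      calc ∑ s', P s a s' * J s' ≤ ∑ s', (P s a s' * K s' + P s a s' * dist J K) := by
            refine Finset.sum_le_sum fun s' _ => ?_
            rw [← mul_add]
            refine mul_le_mul_of_nonneg_left ?_ (hP0 s a s')
            have h2 := dist_le_pi_dist J K s'
            rw [Real.dist_eq] at h2
            linarith [le_abs_self (J s' - K s')]
        _ = _ := by rw [Finset.sum_add_distrib, ← Finset.sum_mul, hP1, one_mul]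
    have h3 := mul_le_mul_of_nonneg_left h1 hγ0
    have h4 := Finset.le_sup' (fun a => R s a + γ * ∑ s', P s a s' * K s') (Finset.mem_univ a)
    linarith
  have hc : ContractingWith ⟨γ, hγ0⟩ T := by
    refine ⟨by exact_mod_cast hγ1, LipschitzWith.of_dist_le_mul fun J K => ?_⟩
    change dist (T J) (T K) ≤ γ * dist J K
    refine (dist_pi_le_iff (mul_nonneg hγ0 dist_nonneg)).2 fun s => ?_
    rw [Real.dist_eq, abs_le]
    have h1 := key J K s
    have h2 := key K J s
    rw [dist_comm K J] at h2
    constructor <;> linarith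
  exact ⟨ContractingWith.fixedPoint T hc, hc.fixedPoint_isFixedPt, fun y hy => hc.fixedPoint_unique hy⟩
end

section
/- The operator F is a contraction with modulus γ in the supremum norm: for all Q₁, Q₂ : S → ℝ, ‖F Q₁ − F Q₂‖ ≤ γ · ‖Q₁ − Q₂‖. -/
open Finset

/-- The operator `F` is a `γ`-contraction in the sup norm. -/
theorem F_operator_contraction
    {S A : Type*} [Fintype S] [Nonempty S] [Fintype A] [Nonempty A]
    (R : S → A → ℝ) (G : S → ℝ) (γ : ℝ) (hγ0 : 0 ≤ γ) (hγ1 : γ < 1)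
    (P : S → A → S → ℝ)
    (hP0 : ∀ s a s', 0 ≤ P s a s')
    (hP1 : ∀ s a, ∑ s', P s a s' = 1)
    (F : (S → ℝ) → (S → ℝ))
    (hF : ∀ Q : S → ℝ, ∀ s : S,
      F Q s = univ.sup' univ_nonempty
        (fun a => R s a + γ * ∑ s', P s a s' * min (G s') (Q s'))) :
    ∀ Q₁ Q₂ : S → ℝ, ‖F Q₁ - F Q₂‖ ≤ γ * ‖Q₁ - Q₂‖ := by
  have key : ∀ Q₁ Q₂ : S → ℝ, ∀ s, F Q₁ s ≤ F Q₂ s + γ * ‖Q₁ - Q₂‖ := by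
    intro Q₁ Q₂ s
    rw [hF Q₁ s]
    refine Finset.sup'_le _ _ fun a _ => ?_
    have h1 : R s a + γ * ∑ s', P s a s' * min (G s') (Q₂ s') ≤ F Q₂ s := by
      rw [hF Q₂ s]
      exact Finset.le_sup' (fun a => R s a + γ * ∑ s', P s a s' * min (G s') (Q₂ s'))
        (Finset.mem_univ a)
    have h2 : ∑ s', P s a s' * min (G s') (Q₁ s')
        ≤ ∑ s', P s a s' * min (G s') (Q₂ s') + ‖Q₁ - Q₂‖ := by
      calc ∑ s', P s a s' * min (G s') (Q₁ s')
          ≤ ∑ s', P s a s' * (min (G s') (Q₂ s') + ‖Q₁ - Q₂‖) := by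
            refine Finset.sum_le_sum fun t _ => mul_le_mul_of_nonneg_left ?_ (hP0 s a t)
            have h3 : Q₁ t - Q₂ t ≤ ‖Q₁ - Q₂‖ :=
              (le_abs_self _).trans (norm_le_pi_norm (Q₁ - Q₂) t)
            have h4 := norm_nonneg (Q₁ - Q₂)
            rw [← min_add_add_right]
            exact min_le_min (by linarith) (by linarith)
        _ = _ := by
            simp only [mul_add, Finset.sum_add_distrib]
            rw [← Finset.sum_mul, hP1, one_mul]
    have h5 := mul_le_mul_of_nonneg_left h2 hγ0
    rw [mul_add] at h5
    linarith
  intro Q₁ Q₂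
  refine (pi_norm_le_iff_of_nonneg (mul_nonneg hγ0 (norm_nonneg _))).2 fun s => ?_
  have h1 := key Q₁ Q₂ s
  have h2 := key Q₂ Q₁ s
  rw [norm_sub_rev] at h2
  rw [Pi.sub_apply, Real.norm_eq_abs, abs_le]
  constructor <;> linarith
end

section
/- The operator F̃ is a contraction with modulus γ in the supremum norm: for all Q₁, Q₂ : S → ℝ, ‖F̃ Q₁ − F̃ Q₂‖ ≤ γ · ‖Q₁ − Q₂‖. -/
open Finset

/-- The operator `F̃` (defined from the stopping region `{s | G s ≤ b s}`) is a
`γ`-contraction in the sup norm. -/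
theorem Ftilde_operator_contraction
    {S A : Type*} [Fintype S] [Nonempty S] [Fintype A] [Nonempty A]
    (R : S → A → ℝ) (G : S → ℝ) (γ : ℝ) (hγ0 : 0 ≤ γ) (hγ1 : γ < 1)
    (P : S → A → S → ℝ)
    (hP0 : ∀ s a s', 0 ≤ P s a s')
    (hP1 : ∀ s a, ∑ s', P s a s' = 1)
    (b : S → ℝ)
    (H : (S → ℝ) → (S → ℝ))
    (hH : ∀ Q : S → ℝ, ∀ s : S, H Q s = if G s ≤ b s then G s else Q s)
    (Ftilde : (S → ℝ) → (S → ℝ))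
    (hFtilde : ∀ Q : S → ℝ, ∀ s : S,
      Ftilde Q s = univ.sup' univ_nonempty
        (fun a => R s a + γ * ∑ s', P s a s' * H Q s')) :
    ∀ Q₁ Q₂ : S → ℝ, ‖Ftilde Q₁ - Ftilde Q₂‖ ≤ γ * ‖Q₁ - Q₂‖ := by
  have hHd : ∀ Q₁ Q₂ : S → ℝ, ∀ s, H Q₁ s ≤ H Q₂ s + ‖Q₁ - Q₂‖ := by
    intro Q₁ Q₂ s
    rw [hH, hH]
    split_ifs
    · linarith [norm_nonneg (Q₁ - Q₂)]
    · have h := norm_le_pi_norm (Q₁ - Q₂) s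
      rw [Pi.sub_apply, Real.norm_eq_abs] at h
      linarith [le_abs_self (Q₁ s - Q₂ s)]
  have key : ∀ Q₁ Q₂ : S → ℝ, ∀ s, Ftilde Q₁ s ≤ Ftilde Q₂ s + γ * ‖Q₁ - Q₂‖ := by
    intro Q₁ Q₂ s
    rw [hFtilde Q₁]
    apply Finset.sup'_le
    intro a _
    have h1 : R s a + γ * ∑ s', P s a s' * H Q₂ s' ≤ Ftilde Q₂ s := by
      rw [hFtilde Q₂]
      exact Finset.le_sup' (fun a => R s a + γ * ∑ s', P s a s' * H Q₂ s') (mem_univ a)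
    have h2 : ∑ s', P s a s' * H Q₁ s' ≤ ∑ s', P s a s' * H Q₂ s' + ‖Q₁ - Q₂‖ := by
      calc ∑ s', P s a s' * H Q₁ s'
          ≤ ∑ s', P s a s' * (H Q₂ s' + ‖Q₁ - Q₂‖) :=
            Finset.sum_le_sum fun s' _ =>
              mul_le_mul_of_nonneg_left (hHd Q₁ Q₂ s') (hP0 s a s')
        _ = _ := by
            simp only [mul_add, Finset.sum_add_distrib]
            rw [← Finset.sum_mul, hP1, one_mul]
    have h3 := mul_le_mul_of_nonneg_left h2 hγ0
    rw [mul_add] at h3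
    linarith
  intro Q₁ Q₂
  rw [pi_norm_le_iff_of_nonneg (mul_nonneg hγ0 (norm_nonneg _))]
  intro s
  rw [Pi.sub_apply, Real.norm_eq_abs, abs_le]
  have h1 := key Q₁ Q₂ s
  have h2 := key Q₂ Q₁ s
  rw [norm_sub_rev] at h2
  constructor <;> linarith
end
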